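/- arXiv:1908.02692 — 2 statements merged into one kernel-verified Lean document; each statement's English description precedes it below -/
import Mathlib

section
/- Let X be a finite set of N distinct points in R^n with similarity matrix A = Z_X and weight vector w_X = A^{-1} 1, and let Y be a nonempty proper subset of X. Then the magnitude of X \ Y satisfies |X \ Y| = |X| - r^T S r, where r is the restriction of w_X to the indices corresponding to Y, and S = A_Y - A_{Y,Y^c} (A_{Y^c})^{-1} (A_{Y,Y^c})^T is the Schur complement of the principal submatrix A_{Y^c} (indexed by X \ Y) in A, with A_Y the principal submatrix indexed by Y and A_{Y,Y^c} the off-diagonal block with rows indexed by Y and columns by X \ Y. -/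
open Matrix

/-- The similarity matrix of a family of points in Euclidean space:
entries `exp (-‖xᵢ - xⱼ‖)`. -/
noncomputable def simMatrix {m : Type*} {n : ℕ} (x : m → EuclideanSpace ℝ (Fin n)) :
    Matrix m m ℝ :=
  Matrix.of fun i j => Real.exp (-dist (x i) (x j))

/-- The magnitude of a finite metric space with similarity matrix `A`: the sum of all the
entries of `A⁻¹`. -/
noncomputable def magnitude {m : Type*} [Fintype m] [DecidableEq m] (A : Matrix m m ℝ) : ℝ :=
  ∑ i, ∑ j, A⁻¹ i j

/-- The Schur complement of the principal submatrix `A_{Pᶜ}` in `A`: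
`A/A_{Pᶜ} = A_P - A_{P,Pᶜ} (A_{Pᶜ})⁻¹ (A_{P,Pᶜ})ᵀ`. -/
noncomputable def schurCompl {N : ℕ} (A : Matrix (Fin N) (Fin N) ℝ) (P : Finset (Fin N)) :
    Matrix ↥P ↥P ℝ :=
  A.submatrix ((↑) : ↥P → Fin N) ((↑) : ↥P → Fin N) -
    A.submatrix ((↑) : ↥P → Fin N) ((↑) : ↥Pᶜ → Fin N) *
      (A.submatrix ((↑) : ↥Pᶜ → Fin N) ((↑) : ↥Pᶜ → Fin N))⁻¹ *
      (A.submatrix ((↑) : ↥P → Fin N) ((↑) : ↥Pᶜ → Fin N))ᵀ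


theorem quad_eq {ι : Type*} [Fintype ι] (M : Matrix ι ι ℝ) (c : ι → ℝ) :
    star c ⬝ᵥ (M *ᵥ c) = ∑ i, ∑ j, c i * c j * M i j := by
  simp only [dotProduct, mulVec, star_trivial, Finset.mul_sum]
  refine Finset.sum_congr rfl fun i _ => Finset.sum_congr rfl fun j _ => by ring

theorem psd_iff_quad {ι : Type*} [Fintype ι] (M : Matrix ι ι ℝ) (hs : ∀ i j, M i j = M j i)
    (h : ∀ c : ι → ℝ, 0 ≤ ∑ i, ∑ j, c i * c j * M i j) : M.PosSemidef := by
  refine .of_dotProduct_mulVec_nonneg ?_ fun c => ?_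
  · ext i j
    simp [hs i j]
  · rw [quad_eq]; exact h c

/-- Entrywise powers of a PSD matrix. -/
theorem psd_pow {ι : Type*} [Fintype ι] {K : Matrix ι ι ℝ} (hK : K.PosSemidef) (k : ℕ) :
    (Matrix.of fun i j => K i j ^ k).PosSemidef := by
  induction k with
  | zero =>
    refine psd_iff_quad _ (by simp) fun c => ?_
    have : ∑ i, ∑ j, c i * c j * (Matrix.of fun i j => K i j ^ 0) i j = (∑ i, c i) ^ 2 := by
      simp [sq, Finset.sum_mul_sum]
    rw [this]; positivity
  | succ k ih =>
    have := ih.hadamard hK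
    have e : (Matrix.of fun i j => K i j ^ (k + 1)) = (Matrix.of fun i j => K i j ^ k) ⊙ K := by
      ext i j
      simp [pow_succ]
    rw [e]
    exact this

theorem psd_exp {ι : Type*} [Fintype ι] {K : Matrix ι ι ℝ} (hK : K.PosSemidef) :
    (Matrix.of fun i j => Real.exp (K i j)).PosSemidef := by
  have hsym : ∀ i j, K i j = K j i := fun i j => by
    have := congrFun (congrFun hK.1 j) i
    simpa using this
  refine psd_iff_quad _ (fun i j => by simp [hsym i j]) fun c => ?_
  have h1 : HasSum (fun k : ℕ => ∑ i, ∑ j, c i * c j * (K i j ^ k / (k.factorial : ℝ)))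
      (∑ i, ∑ j, c i * c j * Real.exp (K i j)) := by
    refine hasSum_sum fun i _ => hasSum_sum fun j _ => HasSum.mul_left _ ?_
    rw [Real.exp_eq_exp_ℝ]
    exact NormedSpace.expSeries_div_hasSum_exp (K i j)
  refine h1.nonneg fun k => ?_
  have h2 := (psd_pow hK k).dotProduct_mulVec_nonneg c
  rw [quad_eq] at h2
  have : ∑ i, ∑ j, c i * c j * (K i j ^ k / (k.factorial : ℝ)) =
      (∑ i, ∑ j, c i * c j * (Matrix.of fun i j => K i j ^ k) i j) / (k.factorial : ℝ) := by
    simp [Finset.sum_div, mul_div_assoc]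
  rw [this]; positivity

theorem gauss_nonneg {ι E : Type*} [Fintype ι] [NormedAddCommGroup E] [InnerProductSpace ℝ E]
    (x : ι → E) (c : ι → ℝ) {u : ℝ} (hu : 0 ≤ u) :
    0 ≤ ∑ i, ∑ j, c i * c j * Real.exp (-(u * dist (x i) (x j) ^ 2)) := by
  have h := psd_exp (posSemidef_gram ℝ fun i => Real.sqrt (2 * u) • x i)
  have h2 := h.dotProduct_mulVec_nonneg fun i => c i * Real.exp (-(u * ‖x i‖ ^ 2))
  rw [quad_eq] at h2
  refine h2.trans_eq (Finset.sum_congr rfl fun i _ => Finset.sum_congr rfl fun j _ => ?_)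
  have e : -(u * dist (x i) (x j) ^ 2) = -(u * ‖x i‖ ^ 2) + -(u * ‖x j‖ ^ 2) +
      inner ℝ (Real.sqrt (2 * u) • x i) (Real.sqrt (2 * u) • x j) := by
    rw [dist_eq_norm, norm_sub_sq_real, inner_smul_left, inner_smul_right]
    have : Real.sqrt (2 * u) * Real.sqrt (2 * u) = 2 * u := Real.mul_self_sqrt (by positivity)
    simp only [conj_trivial]
    rw [← mul_assoc, this]; ring
  rw [e, Real.exp_add, Real.exp_add, Matrix.of_apply, gram_apply]
  ring

theorem rat_nonneg {ι E : Type*} [Fintype ι] [NormedAddCommGroup E] [InnerProductSpace ℝ E]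
    (x : ι → E) (c : ι → ℝ) {t : ℝ} (ht : 0 < t) :
    0 ≤ ∑ i, ∑ j, c i * c j * (t + dist (x i) (x j) ^ 2)⁻¹ := by
  have hneg : ∀ i j, -(t + dist (x i) (x j) ^ 2) < 0 := fun i j => by
    have := sq_nonneg (dist (x i) (x j)); linarith
  have hint : ∀ i j, (t + dist (x i) (x j) ^ 2)⁻¹ =
      ∫ u in Set.Ioi (0 : ℝ), Real.exp (-(t + dist (x i) (x j) ^ 2) * u) := fun i j => by
    rw [integral_exp_mul_Ioi (hneg i j)]
    rw [mul_zero, Real.exp_zero, neg_div_neg_eq, one_div]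
  have hi : ∀ i j, MeasureTheory.IntegrableOn
      (fun u : ℝ => c i * c j * Real.exp (-(t + dist (x i) (x j) ^ 2) * u)) (Set.Ioi 0) :=
    fun i j => (integrableOn_exp_mul_Ioi (hneg i j) 0).const_mul _
  have : ∑ i, ∑ j, c i * c j * (t + dist (x i) (x j) ^ 2)⁻¹ =
      ∫ u in Set.Ioi (0 : ℝ), ∑ i, ∑ j, c i * c j * Real.exp (-(t + dist (x i) (x j) ^ 2) * u) := by
    rw [MeasureTheory.integral_finsetSum _
      fun i _ => MeasureTheory.integrable_finsetSum _ fun j _ => hi i j]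
    refine Finset.sum_congr rfl fun i _ => ?_
    rw [MeasureTheory.integral_finsetSum _ fun j _ => hi i j]
    refine Finset.sum_congr rfl fun j _ => ?_
    rw [MeasureTheory.integral_const_mul, ← hint]
  rw [this]
  refine MeasureTheory.setIntegral_nonneg measurableSet_Ioi fun u hu => ?_
  have h := mul_nonneg (Real.exp_pos (-(t * u))).le (gauss_nonneg x c (le_of_lt hu))
  refine h.trans_eq ?_
  rw [Finset.mul_sum]
  refine Finset.sum_congr rfl fun i _ => ?_
  rw [Finset.mul_sum]
  refine Finset.sum_congr rfl fun j _ => ?_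
  have : -(t + dist (x i) (x j) ^ 2) * u = -(t * u) + -(u * dist (x i) (x j) ^ 2) := by ring
  rw [this, Real.exp_add]; ring

theorem dist_cnd {ι E : Type*} [Fintype ι] [NormedAddCommGroup E] [InnerProductSpace ℝ E]
    (x : ι → E) (c : ι → ℝ) (hc : ∑ i, c i = 0) :
    ∑ i, ∑ j, c i * c j * dist (x i) (x j) ≤ 0 := by
  have hp : (1 / 2 : ℝ) ∈ Set.Ioo (0 : ℝ) 1 := by constructor <;> norm_num
  have hI := fun i j => Real.integral_rpowIntegrand₀₁_eq_rpow_mul_const hp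
    (sq_nonneg (dist (x i) (x j)))
  have hint := fun i j => Real.integrableOn_rpowIntegrand₀₁_Ioi hp
    (sq_nonneg (dist (x i) (x j)))
  have hpos := Real.integral_rpowIntegrand₀₁_one_pos hp
  set C := ∫ t in Set.Ioi (0 : ℝ), Real.rpowIntegrand₀₁ (1 / 2) t 1 with hC
  have hsq : ∀ i j, (dist (x i) (x j) ^ 2) ^ (1 / 2 : ℝ) = dist (x i) (x j) := fun i j => by
    rw [← Real.sqrt_eq_rpow, Real.sqrt_sq dist_nonneg]
  have key : (∑ i, ∑ j, c i * c j * dist (x i) (x j)) * C =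
      ∫ t in Set.Ioi (0 : ℝ), ∑ i, ∑ j,
        c i * c j * Real.rpowIntegrand₀₁ (1 / 2) t (dist (x i) (x j) ^ 2) := by
    have hi := fun i j => (hint i j).const_mul (c i * c j)
    rw [MeasureTheory.integral_finsetSum _
      fun i _ => MeasureTheory.integrable_finsetSum _ fun j _ => hi i j, Finset.sum_mul]
    refine Finset.sum_congr rfl fun i _ => ?_
    rw [MeasureTheory.integral_finsetSum _ fun j _ => hi i j, Finset.sum_mul]
    refine Finset.sum_congr rfl fun j _ => ?_
    rw [MeasureTheory.integral_const_mul, hI, hsq]; ring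
  have : (∑ i, ∑ j, c i * c j * dist (x i) (x j)) * C ≤ 0 := by
    rw [key]
    refine MeasureTheory.setIntegral_nonpos measurableSet_Ioi fun t ht => ?_
    have h1 := rat_nonneg x c ht
    have h2 : ∑ i, ∑ j, c i * c j * Real.rpowIntegrand₀₁ (1 / 2) t (dist (x i) (x j) ^ 2) =
        t ^ (1 / 2 : ℝ) * ((∑ i, c i) * (∑ j, c j) * t⁻¹ -
          ∑ i, ∑ j, c i * c j * (t + dist (x i) (x j) ^ 2)⁻¹) := by
      rw [Finset.sum_mul_sum]
      simp only [Real.rpowIntegrand₀₁, Finset.sum_mul, Finset.mul_sum, ← Finset.sum_sub_distrib]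
      refine Finset.sum_congr rfl fun i _ => Finset.sum_congr rfl fun j _ => by ring
    rw [h2, hc]
    have : 0 ≤ t ^ (1 / 2 : ℝ) := Real.rpow_nonneg (le_of_lt ht) _
    nlinarith
  exact nonpos_of_mul_nonpos_left this hpos

theorem exp_gram_pd {ι E : Type*} [Fintype ι] [NormedAddCommGroup E] [InnerProductSpace ℝ E]
    (y : ι → E) (hy : Function.Injective y) :
    (Matrix.of fun i j => Real.exp (inner ℝ (y i) (y j))).PosDef := by
  have hps : (Matrix.of fun i j => Real.exp (inner ℝ (y i) (y j))).PosSemidef :=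
    psd_exp (posSemidef_gram ℝ y)
  refine .of_dotProduct_mulVec_pos hps.1 fun c hc => ?_
  refine (hps.dotProduct_mulVec_nonneg c).lt_of_ne' fun h0 => hc ?_
  rw [quad_eq] at h0
  have hv : ∀ v : E, ∑ j, c j * Real.exp (inner ℝ v (y j)) = 0 := by
    intro v
    have h1 := psd_exp (posSemidef_gram ℝ fun o : Option ι => o.elim v y)
    have h2 := (h1.dotProduct_mulVec_zero_iff fun o : Option ι => o.elim 0 c).1 (by
      rw [quad_eq]
      simpa [Fintype.sum_option] using h0)
    have h3 := congrFun h2 none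
    simpa [mulVec, dotProduct, Fintype.sum_option, mul_comm] using h3
  let f : ι → (Multiplicative E →* ℝ) := fun j =>
    { toFun := fun v => Real.exp (inner ℝ v.toAdd (y j))
      map_one' := by simp
      map_mul' := fun a b => by simp [inner_add_left, Real.exp_add] }
  have hf : Function.Injective f := fun i j hij => hy (by
    refine ext_inner_left ℝ fun v => ?_
    have := DFunLike.congr_fun hij (Multiplicative.ofAdd v)
    exact Real.exp_injective this)
  have hli := (linearIndependent_monoidHom (Multiplicative E) ℝ).comp f hf
  rw [Fintype.linearIndependent_iff] at hli
  funext j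
  refine hli c ?_ j
  funext v
  simpa [f] using hv v.toAdd

theorem exp_pd {ι : Type*} [Fintype ι] {K : Matrix ι ι ℝ} (hK : K.PosSemidef)
    (hd : ∀ i j, i ≠ j → K i i + K j j - 2 * K i j ≠ 0) :
    (Matrix.of fun i j => Real.exp (K i j)).PosDef := by
  classical
  obtain ⟨B, hB⟩ : ∃ B : Matrix ι ι ℝ, K = Bᴴ * B := by
    open scoped MatrixOrder Matrix.Norms.L2Operator in
    exact CStarAlgebra.nonneg_iff_eq_star_mul_self.mp hK.nonneg
  let y : ι → EuclideanSpace ℝ ι := fun i => WithLp.toLp 2 fun k => B k i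
  have hin : ∀ i j, inner ℝ (y i) (y j) = K i j := fun i j => by
    simp [hB, y, Matrix.mul_apply, PiLp.inner_apply, mul_comm]
  have := exp_gram_pd y (fun i j hij => by
    by_contra hne
    apply hd i j hne
    rw [← hin, ← hin, ← hin, hij]; ring)
  simpa only [hin] using this

theorem simMatrix_posDef {m : Type*} [Fintype m] {n : ℕ} (x : m → EuclideanSpace ℝ (Fin n))
    (hx : Function.Injective x) : (simMatrix x).PosDef := by
  let K : Matrix m m ℝ := Matrix.of fun i j => ‖x i‖ + ‖x j‖ - dist (x i) (x j)
  have hK : K.PosSemidef := by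
    refine psd_iff_quad _ (fun i j => by simp [K, dist_comm, add_comm]) fun c => ?_
    have h := dist_cnd (fun o : Option m => o.elim 0 x) (fun o => o.elim (-∑ i, c i) c)
      (by simp [Fintype.sum_option])
    simp only [Fintype.sum_option, Option.elim, dist_self, dist_zero_left, dist_zero_right,
      norm_zero, mul_zero, Finset.sum_add_distrib] at h
    have e : ∑ i, ∑ j, c i * c j * K i j = (∑ i, c i * ‖x i‖) * (∑ j, c j) +
        (∑ i, c i) * (∑ j, c j * ‖x j‖) - ∑ i, ∑ j, c i * c j * dist (x i) (x j) := by
      rw [Finset.sum_mul_sum, Finset.sum_mul_sum]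
      simp only [← Finset.sum_add_distrib, ← Finset.sum_sub_distrib]
      refine Finset.sum_congr rfl fun i _ => Finset.sum_congr rfl fun j _ => ?_
      simp only [K, Matrix.of_apply]; ring
    have e1 : ∑ j, -(∑ i, c i) * c j * ‖x j‖ = -((∑ i, c i) * (∑ j, c j * ‖x j‖)) := by
      rw [← neg_mul, Finset.mul_sum]
      exact Finset.sum_congr rfl fun j _ => by ring
    have e2 : ∑ j, c j * -(∑ i, c i) * ‖x j‖ = -((∑ i, c i) * (∑ j, c j * ‖x j‖)) := by
      rw [← neg_mul, Finset.mul_sum]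
      exact Finset.sum_congr rfl fun j _ => by ring
    rw [e1, e2] at h
    rw [e]
    nlinarith [mul_comm (∑ i, c i * ‖x i‖) (∑ j, c j)]
  have hpd := exp_pd hK fun i j hij => by
    have : 0 < dist (x i) (x j) := dist_pos.2 (hx.ne hij)
    simp only [K, Matrix.of_apply, dist_self]
    intro h
    linarith
  refine .of_dotProduct_mulVec_pos ?_ fun c hc => ?_
  · ext i j
    simp [simMatrix, dist_comm]
  have h := hpd.dotProduct_mulVec_pos (x := fun i => c i * Real.exp (-‖x i‖)) (by
    intro h0
    apply hc
    funext i
    have := congrFun h0 i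
    simpa [Real.exp_ne_zero] using this)
  rw [quad_eq] at h ⊢
  refine h.trans_eq (Finset.sum_congr rfl fun i _ => Finset.sum_congr rfl fun j _ => ?_)
  have e : -dist (x i) (x j) = -‖x i‖ + -‖x j‖ + K i j := by simp only [K, Matrix.of_apply]; ring
  simp only [simMatrix, Matrix.of_apply]
  rw [e, Real.exp_add, Real.exp_add]
  ring

theorem magnitude_eq {m : Type*} [Fintype m] [DecidableEq m] (A : Matrix m m ℝ) :
    magnitude A = 1 ⬝ᵥ (A⁻¹ *ᵥ 1) := by
  simp [magnitude, dotProduct, mulVec]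

theorem block_algebra {p q : Type*} [Fintype p] [Fintype q] [DecidableEq q]
    (B : Matrix p p ℝ) (C : Matrix p q ℝ) (D : Matrix q q ℝ) (hD : IsUnit D) (hDs : Dᵀ = D)
    (u : p → ℝ) (v : q → ℝ) (h1 : B *ᵥ u + C *ᵥ v = 1) (h2 : Cᵀ *ᵥ u + D *ᵥ v = 1) :
    1 ⬝ᵥ (D⁻¹ *ᵥ 1) = 1 ⬝ᵥ u + 1 ⬝ᵥ v - u ⬝ᵥ ((B - C * D⁻¹ * Cᵀ) *ᵥ u) := by
  have hdet : IsUnit D.det := (Matrix.isUnit_iff_isUnit_det D).1 hD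
  have hz : D⁻¹ *ᵥ 1 = D⁻¹ *ᵥ (Cᵀ *ᵥ u) + v := by
    rw [← h2, mulVec_add, mulVec_mulVec v, Matrix.nonsing_inv_mul _ hdet, one_mulVec]
  have hB : B *ᵥ u = 1 - C *ᵥ v := by rw [← h1]; simp
  have hinv : (D⁻¹)ᵀ = D⁻¹ := by rw [Matrix.transpose_nonsing_inv, hDs]
  have h3 : (1 : q → ℝ) ⬝ᵥ (D⁻¹ *ᵥ (Cᵀ *ᵥ u)) = u ⬝ᵥ (C *ᵥ (D⁻¹ *ᵥ 1)) := by
    rw [dotProduct_mulVec, ← mulVec_transpose, hinv, dotProduct_mulVec, vecMul_transpose,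
      dotProduct_comm]
  have h4 : (1 : q → ℝ) ⬝ᵥ (D⁻¹ *ᵥ 1) = 1 ⬝ᵥ (D⁻¹ *ᵥ (Cᵀ *ᵥ u)) + 1 ⬝ᵥ v := by
    rw [hz, dotProduct_add]
  rw [h4, h3, hz, sub_mulVec, hB, ← mulVec_mulVec, ← mulVec_mulVec, mulVec_add]
  simp only [dotProduct_add, dotProduct_sub]
  rw [dotProduct_comm u 1]
  ring

/-- For a finite set `X` of distinct points of `ℝⁿ` and a nonempty proper subset `Y ⊆ X`
(indexed by `P`), `|X \ Y| = |X| - w_X|_Y ᵀ (ζ_X/ζ_{X\Y}) w_X|_Y`. -/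
theorem magnitude_diff {N n : ℕ} (x : Fin N → EuclideanSpace ℝ (Fin n))
    (hx : Function.Injective x) (P : Finset (Fin N)) (hP : P.Nonempty)
    (hP' : P ≠ Finset.univ) :
    magnitude (simMatrix (fun i : ↥Pᶜ => x i)) =
      magnitude (simMatrix x) -
        (fun i : ↥P => ((simMatrix x)⁻¹ *ᵥ 1) i) ⬝ᵥ
          (schurCompl (simMatrix x) P *ᵥ fun i : ↥P => ((simMatrix x)⁻¹ *ᵥ 1) i) := by
  have hA := simMatrix_posDef x hx
  have hDd := simMatrix_posDef (fun i : ↥Pᶜ => x i) (hx.comp Subtype.val_injective)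
  have hDeq : (simMatrix x).submatrix ((↑) : ↥Pᶜ → Fin N) ((↑) : ↥Pᶜ → Fin N) =
      simMatrix (fun i : ↥Pᶜ => x i) := rfl
  set A := simMatrix x with hAdef
  set w := A⁻¹ *ᵥ (1 : Fin N → ℝ) with hw
  have hAs : ∀ i j, A i j = A j i := fun i j => by simp [A, simMatrix, dist_comm]
  have hAw : A *ᵥ w = 1 := by
    rw [hw, mulVec_mulVec, Matrix.mul_nonsing_inv _ ((Matrix.isUnit_iff_isUnit_det A).1 hA.isUnit),
      one_mulVec]
  have hsplit : ∀ f : Fin N → ℝ, ∑ i, f i = ∑ i : ↥P, f i + ∑ i : ↥Pᶜ, f i := fun f => by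
    rw [Finset.sum_coe_sort, Finset.sum_coe_sort, Finset.sum_add_sum_compl]
  rw [magnitude_eq, magnitude_eq, ← hw]
  unfold schurCompl
  rw [hDeq]
  have e : (1 : Fin N → ℝ) ⬝ᵥ w =
      (1 : ↥P → ℝ) ⬝ᵥ (fun i : ↥P => w i) + (1 : ↥Pᶜ → ℝ) ⬝ᵥ (fun i : ↥Pᶜ => w i) := by
    simp only [dotProduct, Pi.one_apply, one_mul]
    exact hsplit w
  rw [e]
  refine block_algebra _ _ _ hDd.isUnit ?_ _ _ ?_ ?_
  · exact hDd.isHermitian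
  · funext i
    have := congrFun hAw i
    simp only [mulVec, dotProduct] at this
    rw [hsplit] at this
    exact this
  · funext i
    have := congrFun hAw i
    simp only [mulVec, dotProduct] at this
    rw [hsplit] at this
    refine Eq.trans ?_ this
    simp only [Pi.add_apply, mulVec, dotProduct, transpose_apply, submatrix_apply]
    congr 1
    exact Finset.sum_congr rfl fun j _ => by rw [hAs]
end

section
/- Let X be a finite set of N distinct points in R^n with similarity matrix A = Z_X, inverse B = A^{-1}, and weight vector w = B 1. Let P be a nonempty proper subset of the index set with complement Pbar, and let B_P be the principal submatrix of B indexed by P. Then for every index i in Pbar, the i-th entry of (A_{Pbar})^{-1} 1_{Pbar} (i.e., the i-th row sum of the inverse of the principal submatrix A_{Pbar}) equals w(x_i) - (B_{P,i})^T (B_P)^{-1} w[P], where B_{P,i} is the column vector of entries (B(p,i))_{p in P} and w[P] is the restriction of w to the indices in P. -/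
open Matrix

open MeasureTheory Filter Topology

/-- Real quadratic form of a kernel. -/
noncomputable def qf {m : Type*} [Fintype m] (K : m → m → ℝ) (c : m → ℝ) : ℝ :=
  ∑ i, ∑ j, c i * c j * K i j

theorem posSemidef_of_qf {m : Type*} [Fintype m] {K : m → m → ℝ}
    (hs : ∀ i j, K i j = K j i) (hK : ∀ c, 0 ≤ qf K c) : (Matrix.of K).PosSemidef := by
  refine Matrix.PosSemidef.of_dotProduct_mulVec_nonneg ?_ ?_
  · ext i j
    simp [hs j i]
  · intro c
    have h := hK c
    simp only [qf] at h
    simp only [dotProduct, mulVec, Matrix.of_apply, Finset.mul_sum, star_trivial]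
    refine h.trans_eq (Finset.sum_congr rfl fun i _ => Finset.sum_congr rfl fun j _ => by ring)

theorem qf_of_posSemidef {m : Type*} [Fintype m] {K : m → m → ℝ}
    (hK : (Matrix.of K).PosSemidef) (c : m → ℝ) : 0 ≤ qf K c := by
  have h := hK.dotProduct_mulVec_nonneg c
  simp only [qf]
  simp only [dotProduct, mulVec, Matrix.of_apply, Finset.mul_sum, star_trivial] at h
  refine h.trans_eq (Finset.sum_congr rfl fun i _ => Finset.sum_congr rfl fun j _ => by ring)

theorem posSemidef_pow {m : Type*} [Fintype m] {K : m → m → ℝ}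
    (hK : (Matrix.of K).PosSemidef) (k : ℕ) :
    (Matrix.of fun i j => K i j ^ k).PosSemidef := by
  induction k with
  | zero =>
    refine posSemidef_of_qf (by simp) fun c => ?_
    have : qf (fun _ _ : m => (1 : ℝ)) c = (∑ i, c i) ^ 2 := by
      simp [qf, sq, Finset.sum_mul_sum]
    simp only [pow_zero]
    rw [this]; positivity
  | succ k ih =>
    have := ih.hadamard hK
    have e : (Matrix.of fun i j => K i j ^ (k + 1)) =
        (Matrix.of fun i j => K i j ^ k).hadamard (Matrix.of K) := by
      ext i j
      simp [pow_succ]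
    rw [e]
    exact this

theorem qf_exp_tail {m : Type*} [Fintype m] {K : m → m → ℝ}
    (hK : (Matrix.of K).PosSemidef) (c : m → ℝ) :
    0 ≤ qf (fun i j => Real.exp (K i j) - 1 - K i j) c := by
  have h1 : ∀ y : ℝ, HasSum (fun k : ℕ => y ^ (k + 2) / (k + 2).factorial)
      (Real.exp y - 1 - y) := by
    intro y
    have h := NormedSpace.expSeries_div_hasSum_exp (𝔸 := ℝ) y
    rw [← Real.exp_eq_exp_ℝ] at h
    have h2 := (hasSum_nat_add_iff' 2).mpr h
    have e : Real.exp y - ∑ i ∈ Finset.range 2, y ^ i / (i.factorial : ℝ) =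
        Real.exp y - 1 - y := by
      rw [Finset.sum_range_succ, Finset.sum_range_one]
      simp
      ring
    rw [← e]
    exact h2
  have h2 : HasSum (fun k : ℕ => qf (fun i j => K i j ^ (k + 2) / (k + 2).factorial) c)
      (qf (fun i j => Real.exp (K i j) - 1 - K i j) c) := by
    unfold qf
    exact hasSum_sum fun i _ => hasSum_sum fun j _ => (h1 (K i j)).mul_left _
  refine h2.nonneg fun k => ?_
  have h3 := qf_of_posSemidef (posSemidef_pow hK (k + 2)) c
  have h4 : qf (fun i j => K i j ^ (k + 2) / (k + 2).factorial) c =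
      qf (fun i j => K i j ^ (k + 2)) c / (k + 2).factorial := by
    simp only [qf, Finset.sum_div, mul_div_assoc]
  rw [h4]; positivity

theorem qf_add {m : Type*} [Fintype m] (K L : m → m → ℝ) (c : m → ℝ) :
    qf (fun i j => K i j + L i j) c = qf K c + qf L c := by
  simp only [qf, mul_add, Finset.sum_add_distrib]

theorem qf_outer {m : Type*} [Fintype m] (a : m → ℝ) (c : m → ℝ) :
    qf (fun i j => a i * a j) c = (∑ i, c i * a i) ^ 2 := by
  simp only [qf, sq, Finset.sum_mul_sum]
  exact Finset.sum_congr rfl fun i _ => Finset.sum_congr rfl fun j _ => by ring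

theorem qf_conj {m : Type*} [Fintype m] (a : m → ℝ) (K : m → m → ℝ) (c : m → ℝ) :
    qf (fun i j => a i * a j * K i j) c = qf K (fun i => c i * a i) := by
  simp only [qf]
  exact Finset.sum_congr rfl fun i _ => Finset.sum_congr rfl fun j _ => by ring

theorem qf_exp_ge {m : Type*} [Fintype m] {K : m → m → ℝ}
    (hK : (Matrix.of K).PosSemidef) (c : m → ℝ) :
    (∑ i, c i) ^ 2 + qf K c ≤ qf (fun i j => Real.exp (K i j)) c := by
  have h := qf_exp_tail hK c
  have h1 := qf_outer (fun _ : m => (1 : ℝ)) c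
  simp only [mul_one] at h1
  have h2 : qf (fun i j => Real.exp (K i j)) c =
      qf (fun i j => Real.exp (K i j) - 1 - K i j) c + (qf (fun _ _ => 1) c + qf K c) := by
    rw [← qf_add, ← qf_add]
    congr 1; ext i j; ring
  linarith

section gauss
variable {m : Type*} [Fintype m] {n : ℕ} (x : m → EuclideanSpace ℝ (Fin n))

theorem gauss_gram (s : ℝ) :
    (Matrix.of fun i j => 2 * s ^ 2 * inner ℝ (x i) (x j)).PosSemidef := by
  have h := (Matrix.posSemidef_gram ℝ x).smul (a := 2 * s ^ 2) (by positivity)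
  have e : (Matrix.of fun i j => 2 * s ^ 2 * inner ℝ (x i) (x j)) =
      (2 * s ^ 2) • Matrix.gram ℝ x := by
    ext i j
    simp [Matrix.gram]
  rw [e]
  exact h

theorem gauss_factor (s : ℝ) (i j : m) :
    Real.exp (-(dist (x i) (x j) * s) ^ 2) =
      Real.exp (-(‖x i‖ * s) ^ 2) * Real.exp (-(‖x j‖ * s) ^ 2) *
        Real.exp (2 * s ^ 2 * inner ℝ (x i) (x j)) := by
  rw [← Real.exp_add, ← Real.exp_add, dist_eq_norm]
  congr 1
  have := norm_sub_sq_real (x i) (x j)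
  linear_combination (-s ^ 2) * this

theorem gauss_nonneg_s9 (s : ℝ) (c : m → ℝ) :
    0 ≤ qf (fun i j => Real.exp (-(dist (x i) (x j) * s) ^ 2)) c := by
  simp_rw [gauss_factor x s]
  rw [qf_conj (fun i => Real.exp (-(‖x i‖ * s) ^ 2))]
  have h := qf_exp_ge (gauss_gram x s) (fun i => c i * Real.exp (-(‖x i‖ * s) ^ 2))
  have h2 := qf_of_posSemidef (gauss_gram x s) (fun i => c i * Real.exp (-(‖x i‖ * s) ^ 2))
  exact le_trans (by positivity) h

theorem gauss_base_nonneg (s : ℝ) (c : m → ℝ) :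
    0 ≤ qf (fun i j => (1 - Real.exp (-(‖x i‖ * s) ^ 2)) + (1 - Real.exp (-(‖x j‖ * s) ^ 2))
      - (1 - Real.exp (-(dist (x i) (x j) * s) ^ 2))) c := by
  have e : qf (fun i j => (1 - Real.exp (-(‖x i‖ * s) ^ 2)) + (1 - Real.exp (-(‖x j‖ * s) ^ 2))
      - (1 - Real.exp (-(dist (x i) (x j) * s) ^ 2))) c
      + qf (fun i j => Real.exp (-(‖x i‖ * s) ^ 2) * Real.exp (-(‖x j‖ * s) ^ 2)) c =
      qf (fun i j => (1 - Real.exp (-(‖x i‖ * s) ^ 2)) * (1 - Real.exp (-(‖x j‖ * s) ^ 2))) c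
      + qf (fun i j => Real.exp (-(‖x i‖ * s) ^ 2) * Real.exp (-(‖x j‖ * s) ^ 2) *
        Real.exp (2 * s ^ 2 * inner ℝ (x i) (x j))) c := by
    rw [← qf_add, ← qf_add]
    congr 1; ext i j
    rw [gauss_factor x s]; ring
  rw [qf_conj (fun i => Real.exp (-(‖x i‖ * s) ^ 2)),
    qf_outer (fun i => Real.exp (-(‖x i‖ * s) ^ 2)),
    qf_outer (fun i => 1 - Real.exp (-(‖x i‖ * s) ^ 2))] at e
  have h := qf_exp_ge (gauss_gram x s) (fun i => c i * Real.exp (-(‖x i‖ * s) ^ 2))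
  have h2 := qf_of_posSemidef (gauss_gram x s) (fun i => c i * Real.exp (-(‖x i‖ * s) ^ 2))
  have h3 := sq_nonneg (∑ i, c i * (1 - Real.exp (-(‖x i‖ * s) ^ 2)))
  linarith
end gauss

noncomputable def hh (a s : ℝ) : ℝ := (1 - Real.exp (-(a * s) ^ 2)) / s ^ 2

theorem hh_one_nonneg (s : ℝ) : 0 ≤ hh 1 s := by
  unfold hh
  have : Real.exp (-(1 * s) ^ 2) ≤ 1 := Real.exp_le_one_iff.mpr (by nlinarith [sq_nonneg (1 * s)])
  exact div_nonneg (by linarith) (sq_nonneg s)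

theorem hh_one_integrable : Integrable (hh 1) := by
  refine (integrable_inv_one_add_sq.const_mul 2).mono' ?_ ?_
  · apply Measurable.aestronglyMeasurable
    unfold hh
    fun_prop
  · refine Eventually.of_forall fun s => ?_
    rw [Real.norm_of_nonneg (hh_one_nonneg s)]
    unfold hh
    have h1 : 0 < Real.exp (-(1 * s) ^ 2) := Real.exp_pos _
    have h2 := Real.add_one_le_exp (-(1 * s) ^ 2)
    rcases eq_or_ne s 0 with rfl | hs
    · simp
    · have : 0 < s ^ 2 := by positivity
      rw [← div_eq_mul_inv, div_le_div_iff₀ this (by positivity)]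
      nlinarith

theorem hh_scale (a s : ℝ) : hh a s = a ^ 2 * hh 1 (a * s) := by
  unfold hh
  rcases eq_or_ne a 0 with rfl | ha
  · simp
  rcases eq_or_ne s 0 with rfl | hs
  · simp
  · rw [one_mul]; field_simp

theorem hh_integrable (a : ℝ) : Integrable (hh a) := by
  have e : hh a = fun s => a ^ 2 * hh 1 (a * s) := funext fun s => hh_scale a s
  rcases eq_or_ne a 0 with rfl | ha
  · rw [e]; simp
  · rw [e]
    exact (hh_one_integrable.comp_mul_left' ha).const_mul _

theorem hh_integral (a : ℝ) (ha : 0 ≤ a) : ∫ s, hh a s = a * ∫ s, hh 1 s := by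
  simp_rw [hh_scale a]
  rw [integral_const_mul, Measure.integral_comp_mul_left (hh 1) a, smul_eq_mul, abs_inv,
    abs_of_nonneg ha]
  rcases eq_or_ne a 0 with rfl | ha
  · simp
  · field_simp

theorem integral_pos_of_Ioi {f : ℝ → ℝ} (hf : 0 ≤ f) (hi : Integrable f)
    (h : ∀ᶠ s in atTop, 0 < f s) : 0 < ∫ s, f s := by
  rw [integral_pos_iff_support_of_nonneg hf hi]
  obtain ⟨S, hS⟩ := eventually_atTop.mp h
  have : Set.Ici S ⊆ Function.support f := fun s hs => (hS s hs).ne'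
  refine lt_of_lt_of_le ?_ (measure_mono this)
  simp

theorem hh_const_pos : 0 < ∫ s, hh 1 s := by
  refine integral_pos_of_Ioi hh_one_nonneg hh_one_integrable ?_
  filter_upwards [eventually_gt_atTop 0] with s hs
  unfold hh
  have : Real.exp (-(1 * s) ^ 2) < 1 := by
    rw [one_mul]
    refine lt_of_lt_of_eq ?_ Real.exp_zero
    apply Real.exp_lt_exp.mpr
    have : 0 < s ^ 2 := by positivity
    linarith
  exact div_pos (by linarith) (by positivity)

section dist
variable {m : Type*} [Fintype m] {n : ℕ} (x : m → EuclideanSpace ℝ (Fin n))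

theorem qf_integral (K : m → m → ℝ → ℝ) (hK : ∀ i j, Integrable (K i j)) (c : m → ℝ) :
    Integrable (fun s => qf (fun i j => K i j s) c) ∧
    ∫ s, qf (fun i j => K i j s) c = qf (fun i j => ∫ s, K i j s) c := by
  have h1 : ∀ i j, Integrable (fun s => c i * c j * K i j s) := fun i j => (hK i j).const_mul _
  have h2 : ∀ i, Integrable (fun s => ∑ j, c i * c j * K i j s) := fun i =>
    integrable_finsetSum _ fun j _ => h1 i j
  unfold qf
  refine ⟨integrable_finsetSum _ fun i _ => h2 i, ?_⟩
  rw [integral_finsetSum _ fun i _ => h2 i]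
  refine Finset.sum_congr rfl fun i _ => ?_
  rw [integral_finsetSum _ fun j _ => h1 i j]
  refine Finset.sum_congr rfl fun j _ => ?_
  rw [integral_const_mul]

theorem base_nonneg (c : m → ℝ) :
    0 ≤ qf (fun i j => ‖x i‖ + ‖x j‖ - dist (x i) (x j)) c := by
  have h := (qf_integral (fun i j s => hh ‖x i‖ s + hh ‖x j‖ s - hh (dist (x i) (x j)) s)
    (fun i j => ((hh_integrable _).add (hh_integrable _)).sub (hh_integrable _)) c).2
  have e : ∀ i j, ∫ s, (hh ‖x i‖ s + hh ‖x j‖ s - hh (dist (x i) (x j)) s) =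
      (‖x i‖ + ‖x j‖ - dist (x i) (x j)) * ∫ s, hh 1 s := by
    intro i j
    have ha : Integrable (fun s => hh ‖x i‖ s + hh ‖x j‖ s) :=
      (hh_integrable _).add (hh_integrable _)
    rw [integral_sub ha (hh_integrable _),
      integral_add (hh_integrable _) (hh_integrable _), hh_integral _ (norm_nonneg _),
      hh_integral _ (norm_nonneg _), hh_integral _ dist_nonneg]
    ring
  simp_rw [e] at h
  have e2 : qf (fun i j => (‖x i‖ + ‖x j‖ - dist (x i) (x j)) * ∫ s, hh 1 s) c =
      qf (fun i j => ‖x i‖ + ‖x j‖ - dist (x i) (x j)) c * ∫ s, hh 1 s := by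
    simp only [qf, Finset.sum_mul, mul_assoc]
  rw [e2] at h
  refine nonneg_of_mul_nonneg_left (b := ∫ s, hh 1 s) ?_ hh_const_pos
  rw [← h]
  refine integral_nonneg fun s => ?_
  have e3 : qf (fun i j => hh ‖x i‖ s + hh ‖x j‖ s - hh (dist (x i) (x j)) s) c =
    qf (fun i j => (1 - Real.exp (-(‖x i‖ * s) ^ 2)) + (1 - Real.exp (-(‖x j‖ * s) ^ 2))
      - (1 - Real.exp (-(dist (x i) (x j) * s) ^ 2))) c / s ^ 2 := by
    simp only [qf, Finset.sum_div, hh]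
    exact Finset.sum_congr rfl fun i _ => Finset.sum_congr rfl fun j _ => by ring
  simp only [Pi.zero_apply]
  rw [e3]
  exact div_nonneg (gauss_base_nonneg x s c) (sq_nonneg s)

theorem dist_strict (hx : Function.Injective x) (c : m → ℝ) (hc : c ≠ 0) (h0 : ∑ i, c i = 0) :
    qf (fun i j => dist (x i) (x j)) c < 0 := by
  classical
  obtain ⟨hi, h⟩ := qf_integral (fun i j s => -hh (dist (x i) (x j)) s)
    (fun i j => (hh_integrable _).neg) c
  have e : ∀ i j, ∫ s, -hh (dist (x i) (x j)) s = dist (x i) (x j) * -∫ s, hh 1 s := by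
    intro i j
    rw [integral_neg, hh_integral _ dist_nonneg]
    ring
  simp_rw [e] at h
  have e2 : qf (fun i j => dist (x i) (x j) * -∫ s, hh 1 s) c =
      qf (fun i j => dist (x i) (x j)) c * -∫ s, hh 1 s := by
    simp only [qf, Finset.sum_mul, mul_assoc]
  rw [e2] at h
  have e3 : ∀ s, qf (fun i j => -hh (dist (x i) (x j)) s) c =
      qf (fun i j => Real.exp (-(dist (x i) (x j) * s) ^ 2)) c / s ^ 2 := by
    intro s
    have h1 := qf_outer (fun _ : m => (1 : ℝ)) c
    simp only [mul_one, h0] at h1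
    have : qf (fun i j => Real.exp (-(dist (x i) (x j) * s) ^ 2)) c =
      qf (fun i j => Real.exp (-(dist (x i) (x j) * s) ^ 2) - 1) c + qf (fun _ _ => 1) c := by
      rw [← qf_add]; simp
    rw [this, h1]
    simp only [qf, hh]
    rw [zero_pow two_ne_zero, add_zero]
    simp only [Finset.sum_div]
    exact Finset.sum_congr rfl fun i _ => Finset.sum_congr rfl fun j _ => by ring
  have hpos : 0 < ∫ s, qf (fun i j => -hh (dist (x i) (x j)) s) c := by
    refine integral_pos_of_Ioi (fun s => ?_) hi ?_
    · simp only [Pi.zero_apply]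
      rw [e3]
      exact div_nonneg (gauss_nonneg_s9 x s c) (sq_nonneg s)
    · have hl : Tendsto (fun s : ℝ => qf (fun i j => Real.exp (-(dist (x i) (x j) * s) ^ 2)) c)
          atTop (𝓝 (qf (fun i j => if i = j then 1 else 0) c)) := by
        unfold qf
        refine tendsto_finsetSum _ fun i _ => tendsto_finsetSum _ fun j _ =>
          Tendsto.const_mul _ ?_
        by_cases hij : i = j
        · simp [hij]
        · have hd : 0 < dist (x i) (x j) := dist_pos.mpr fun h => hij (hx h)
          simp only [hij, if_false]
          refine Real.tendsto_exp_atBot.comp (tendsto_neg_atTop_atBot.comp ?_)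
          exact (tendsto_pow_atTop two_ne_zero).comp (tendsto_id.const_mul_atTop hd)
      have hq : 0 < qf (fun i j => if i = j then 1 else 0) c := by
        have : qf (fun i j => if i = j then 1 else 0) c = ∑ i, c i * c i := by
          simp [qf]
        rw [this]
        obtain ⟨i, hi⟩ := Function.ne_iff.mp hc
        exact Finset.sum_pos' (fun i _ => mul_self_nonneg _)
          ⟨i, Finset.mem_univ _, mul_self_pos.mpr hi⟩
      filter_upwards [hl.eventually (lt_mem_nhds hq), eventually_gt_atTop 0] with s h1 h2
      rw [e3]
      positivity
  rw [h] at hpos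
  have := hh_const_pos
  nlinarith

theorem simMatrix_posDef_s9 (hx : Function.Injective x) : (simMatrix x).PosDef := by
  refine Matrix.PosDef.of_dotProduct_mulVec_pos ?_ ?_
  · ext i j
    simp [simMatrix, dist_comm]
  intro c hc
  have e0 : star c ⬝ᵥ (simMatrix x *ᵥ c) = qf (fun i j => Real.exp (-dist (x i) (x j))) c := by
    simp only [qf, simMatrix, dotProduct, mulVec, Matrix.of_apply, Finset.mul_sum, star_trivial]
    exact Finset.sum_congr rfl fun i _ => Finset.sum_congr rfl fun j _ => by ring
  rw [e0]
  have e1 : ∀ i j, Real.exp (-dist (x i) (x j)) = Real.exp (-‖x i‖) * Real.exp (-‖x j‖) *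
      Real.exp (‖x i‖ + ‖x j‖ - dist (x i) (x j)) := by
    intro i j
    rw [← Real.exp_add, ← Real.exp_add]; congr 1; ring
  simp_rw [e1]
  rw [qf_conj (fun i => Real.exp (-‖x i‖))]
  set d : m → ℝ := fun i => c i * Real.exp (-‖x i‖) with hd
  have hd0 : d ≠ 0 := by
    obtain ⟨i, hi⟩ := Function.ne_iff.mp hc
    exact Function.ne_iff.mpr ⟨i, mul_ne_zero hi (Real.exp_pos _).ne'⟩
  have hK := posSemidef_of_qf (K := fun i j => ‖x i‖ + ‖x j‖ - dist (x i) (x j))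
    (fun i j => by rw [dist_comm]; ring) (base_nonneg x)
  refine lt_of_lt_of_le ?_ (qf_exp_ge hK d)
  have hb := base_nonneg x d
  by_cases h0 : ∑ i, d i = 0
  · have hs := dist_strict x hx d hd0 h0
    have : qf (fun i j => ‖x i‖ + ‖x j‖ - dist (x i) (x j)) d =
        - qf (fun i j => dist (x i) (x j)) d := by
      have h1 : qf (fun i j => ‖x i‖ + ‖x j‖) d = 0 := by
        simp only [qf_add (fun i _ => ‖x i‖) (fun _ j => ‖x j‖)]
        have a1 : qf (fun i _ => ‖x i‖) d = (∑ i, d i * ‖x i‖) * ∑ j, d j := by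
          simp only [qf, Finset.sum_mul_sum]
          exact Finset.sum_congr rfl fun i _ => Finset.sum_congr rfl fun j _ => by ring
        have a2 : qf (fun _ j => ‖x j‖) d = (∑ j, d j) * (∑ i, d i * ‖x i‖) := by
          simp only [qf, Finset.sum_mul_sum]
          exact Finset.sum_congr rfl fun i _ => Finset.sum_congr rfl fun j _ => by ring
        rw [a1, a2, h0]; ring
      have h2 := qf_add (fun i j => ‖x i‖ + ‖x j‖ - dist (x i) (x j))
        (fun i j => dist (x i) (x j)) d
      simp only [sub_add_cancel] at h2
      linarith
    rw [this, h0]; linarith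
  · have : 0 < (∑ i, d i) ^ 2 := by positivity
    linarith
end dist

theorem block_inv {N : ℕ} (A : Matrix (Fin N) (Fin N) ℝ) (hA : A.PosDef) (P : Finset (Fin N))
    (i : ↥Pᶜ) :
    ((A.submatrix ((↑) : ↥Pᶜ → Fin N) ((↑) : ↥Pᶜ → Fin N))⁻¹ *ᵥ 1) i =
      (A⁻¹ *ᵥ 1) i -
        (fun p : ↥P => A⁻¹ p i) ⬝ᵥ
          ((A⁻¹.submatrix ((↑) : ↥P → Fin N) ((↑) : ↥P → Fin N))⁻¹ *ᵥ
            fun p : ↥P => (A⁻¹ *ᵥ 1) p) := by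
  have hB : A⁻¹.PosDef := hA.inv
  have hBP := hB.submatrix (e := ((↑) : ↥P → Fin N)) Subtype.val_injective
  have hAS := hA.submatrix (e := ((↑) : ↥Pᶜ → Fin N)) Subtype.val_injective
  have hsym : ∀ a b, A⁻¹ a b = A⁻¹ b a := fun a b => by
    simpa using hB.isHermitian.apply b a
  set B := A⁻¹ with hBdef
  set w := B *ᵥ 1 with hw
  set u := (B.submatrix ((↑) : ↥P → Fin N) ((↑) : ↥P → Fin N))⁻¹ *ᵥ fun p : ↥P => w p with hu
  have hABu : A * B = 1 := Matrix.mul_nonsing_inv A hA.det_pos.ne'.isUnit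
  have hBu : B.submatrix ((↑) : ↥P → Fin N) ((↑) : ↥P → Fin N) *ᵥ u = fun p : ↥P => w p := by
    rw [hu, Matrix.mulVec_mulVec, Matrix.mul_nonsing_inv _ hBP.det_pos.ne'.isUnit,
      Matrix.one_mulVec]
  let uh : Fin N → ℝ := fun k => if h : k ∈ P then u ⟨k, h⟩ else 0
  have huh : ∀ k, (B *ᵥ uh) k = ∑ p : ↥P, B k p * u p := by
    intro k
    simp only [mulVec, dotProduct]
    rw [← Finset.sum_subset (Finset.subset_univ P) (fun a _ ha => by simp [uh, ha]),
      ← Finset.sum_coe_sort]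
    exact Finset.sum_congr rfl fun p _ => by simp [uh]
  let z : Fin N → ℝ := w - B *ᵥ uh
  have hzP : ∀ p ∈ P, z p = 0 := by
    intro p hp
    have := congrFun hBu ⟨p, hp⟩
    simp only [mulVec, dotProduct, Matrix.submatrix_apply] at this
    simp only [z, Pi.sub_apply, huh]
    simp only [mulVec, dotProduct] at *
    linarith
  have hAz : A *ᵥ z = 1 - uh := by
    simp only [z, hw]
    rw [Matrix.mulVec_sub, Matrix.mulVec_mulVec, Matrix.mulVec_mulVec, hABu]
    simp
  have hS : A.submatrix ((↑) : ↥Pᶜ → Fin N) ((↑) : ↥Pᶜ → Fin N) *ᵥ (fun k : ↥Pᶜ => z k) = 1 := by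
    ext k
    have hk : (k : Fin N) ∉ P := Finset.mem_compl.mp k.2
    have h1 := congrFun hAz k
    simp only [mulVec, dotProduct, Pi.sub_apply, Pi.one_apply, uh, hk, dif_neg,
      not_false_eq_true, sub_zero] at h1
    rw [Pi.one_apply, ← h1]
    simp only [mulVec, dotProduct, Matrix.submatrix_apply]
    rw [Finset.sum_coe_sort Pᶜ (fun a => A k a * z a)]
    refine Finset.sum_subset (Finset.subset_univ _) fun a _ ha => ?_
    rw [hzP a (by simpa using ha), mul_zero]
  have hfin : (A.submatrix ((↑) : ↥Pᶜ → Fin N) ((↑) : ↥Pᶜ → Fin N))⁻¹ *ᵥ 1 =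
      fun k : ↥Pᶜ => z k := by
    rw [← hS, Matrix.mulVec_mulVec, Matrix.nonsing_inv_mul _ hAS.det_pos.ne'.isUnit,
      Matrix.one_mulVec]
  rw [hfin]
  simp only [z, Pi.sub_apply, huh, dotProduct]
  congr 1
  exact Finset.sum_congr rfl fun p _ => by rw [hsym]

/-- For a finite set `X` of distinct points of `ℝⁿ` with similarity matrix `A`, inverse
`B = A⁻¹` and weight vector `w = B𝟙`, a nonempty proper index subset `P` with complement
`P̄`, and every `i ∈ P̄`: the `i`-th row sum of `(A_{P̄})⁻¹` equals
`w(xᵢ) - (B_{P,i})ᵀ (B_P)⁻¹ w[P]`. -/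
theorem rowSum_inv_principal_submatrix {N n : ℕ} (x : Fin N → EuclideanSpace ℝ (Fin n))
    (hx : Function.Injective x) (P : Finset (Fin N)) (hP : P.Nonempty)
    (hP' : P ≠ Finset.univ) (i : ↥Pᶜ) :
    (((simMatrix x).submatrix ((↑) : ↥Pᶜ → Fin N) ((↑) : ↥Pᶜ → Fin N))⁻¹ *ᵥ 1) i =
      ((simMatrix x)⁻¹ *ᵥ 1) i -
        (fun p : ↥P => (simMatrix x)⁻¹ p i) ⬝ᵥ
          (((simMatrix x)⁻¹.submatrix ((↑) : ↥P → Fin N) ((↑) : ↥P → Fin N))⁻¹ *ᵥ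
            fun p : ↥P => ((simMatrix x)⁻¹ *ᵥ 1) p) := by
  exact block_inv _ (simMatrix_posDef_s9 x hx) P i
end
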